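/- Let $(X,\mathcal{B},\mu,f,T_f)$ be a dissipative composition dynamical system of bounded distortion generated by $W$, with $T_f$ invertible on $L^p(X)$. If $T_f$ has the shadowing property, then $T_f$ is strongly structurally stable. -/

import Mathlib

open MeasureTheory Filter Set ENNReal

/-- Strong structural stability. -/
def StronglyStructurallyStable {E : Type*} [NormedAddCommGroup E]
    [NormedSpace ℂ E] (T : E ≃L[ℂ] E) : Prop :=
  ∀ γ : ℝ, 0 < γ → ∃ ε : ℝ, 0 < ε ∧ ∀ φ : E → E, Continuous φ →
    (∀ x, ‖φ x‖ ≤ ε) → LipschitzWith (Real.toNNReal ε) φ →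
    ∃ h : E ≃ₜ E, (∀ x, h (T x) = T (h x) + φ (h x)) ∧ ∀ x, ‖h x - x‖ ≤ γ

/-- The shadowing property for an invertible operator: every δ-pseudotrajectory
is ε-shadowed by a true trajectory. -/
def HasShadowing {E : Type*} [NormedAddCommGroup E]
    [NormedSpace ℂ E] (T : E ≃L[ℂ] E) : Prop :=
  ∀ ε : ℝ, 0 < ε → ∃ δ : ℝ, 0 < δ ∧ ∀ x : ℤ → E,
    (∀ n : ℤ, ‖T (x n) - x (n + 1)‖ ≤ δ) →
    ∃ y : E, ∀ n : ℤ, ‖(T ^ n) y - x n‖ < ε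

section GreenKernel

lemma Homeomorph.zpow_semiconj {E : Type*} [TopologicalSpace E] {R S : E ≃ₜ E} {h : E → E}
    (hh : ∀ x, h (R x) = S (h x)) (n : ℤ) (x : E) :
    h ((R ^ n) x) = (S ^ n) (h x) := by
  induction n generalizing x with
  | zero => rfl
  | succ n ih =>
    rw [zpow_add_one, zpow_add_one]
    change h ((R ^ (n : ℤ)) (R x)) = (S ^ (n : ℤ)) (S (h x))
    rw [ih, hh]
  | pred n ih =>
    rw [zpow_sub_one, zpow_sub_one]
    change h ((R ^ (-n : ℤ)) (R.symm x)) = (S ^ (-n : ℤ)) (S.symm (h x))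
    rw [ih]
    congr 1
    rw [← S.symm_apply_apply (h (R.symm x)), ← hh, R.apply_symm_apply]

variable {E : Type*} [NormedAddCommGroup E] [NormedSpace ℂ E]

/-- The sum `∑ₖ Aₖ (χ (R⁻ᵏ⁻¹ x))` of a bounded map `χ` along the orbits of `R`, against a
kernel `A` of bounded operators. -/
noncomputable def greenSum (A : ℤ → E →L[ℂ] E) (R : E ≃ₜ E) (χ : E → E) (x : E) : E :=
  ∑' k : ℤ, A k (χ ((R ^ (-k - 1)) x))

variable {A : ℤ → E →L[ℂ] E} {R : E ≃ₜ E} {χ χ' : E → E} {b b' : ℝ}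

lemma norm_green_term_le (hχ : ∀ x, ‖χ x‖ ≤ b) (k : ℤ) (x : E) :
    ‖A k (χ x)‖ ≤ ‖A k‖ * b :=
  (A k).le_opNorm_of_le (hχ x)

lemma summable_green [CompleteSpace E] (hA : Summable fun k => ‖A k‖) (hχ : ∀ x, ‖χ x‖ ≤ b)
    (u : ℤ → E) :
    Summable fun k => A k (χ (u k)) :=
  Summable.of_norm_bounded (hA.mul_right b) fun k => norm_green_term_le hχ k (u k)

lemma norm_greenSum_le (hA : Summable fun k => ‖A k‖) (hχ : ∀ x, ‖χ x‖ ≤ b) (x : E) :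
    ‖greenSum A R χ x‖ ≤ (∑' k, ‖A k‖) * b :=
  tsum_of_norm_bounded (hA.hasSum.mul_right b) fun k => norm_green_term_le hχ k _

lemma continuous_greenSum [CompleteSpace E] (hA : Summable fun k => ‖A k‖) (hχ : ∀ x, ‖χ x‖ ≤ b)
    (hc : Continuous χ) : Continuous (greenSum A R χ) :=
  continuous_tsum (fun k => (A k).continuous.comp (hc.comp (R ^ (-k - 1)).continuous))
    (hA.mul_right b) fun k _ => norm_green_term_le hχ k _

lemma greenSum_sub [CompleteSpace E] (hA : Summable fun k => ‖A k‖) (hχ : ∀ x, ‖χ x‖ ≤ b)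
    (hχ' : ∀ x, ‖χ' x‖ ≤ b') (x : E) :
    greenSum A R χ x - greenSum A R χ' x = greenSum A R (fun y => χ y - χ' y) x := by
  simp only [greenSum, map_sub]
  exact ((summable_green hA hχ _).tsum_sub (summable_green hA hχ' _)).symm

lemma greenSum_semiconj {S : E ≃ₜ E} {h : E → E} (hh : ∀ x, h (R x) = S (h x)) (x : E) :
    greenSum A S χ (h x) = greenSum A R (fun y => χ (h y)) x := by
  simp only [greenSum, Homeomorph.zpow_semiconj hh]

lemma greenSum_apply_map [CompleteSpace E] {T : E ≃L[ℂ] E} (hA : Summable fun k => ‖A k‖)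
    (hA0 : ∀ v, A 0 v = v + T (A (-1) v)) (hAk : ∀ k ≠ 0, ∀ v, A k v = T (A (k - 1) v))
    (hχ : ∀ x, ‖χ x‖ ≤ b) (x : E) :
    greenSum A R χ (R x) = T (greenSum A R χ x) + χ x := by
  have e1 : greenSum A R χ (R x) = ∑' k : ℤ, A k (χ ((R ^ (-k)) x)) := by
    refine tsum_congr fun k => ?_
    rw [show (-k : ℤ) = (-k - 1) + 1 by ring, zpow_add_one]
    ring_nf
    rfl
  have e2 : T (greenSum A R χ x) = ∑' k : ℤ, T (A (k - 1) (χ ((R ^ (-k)) x))) := by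
    rw [greenSum, T.map_tsum, ← (Equiv.subRight (1 : ℤ)).tsum_eq]
    refine tsum_congr fun k => ?_
    simp only [Equiv.subRight_apply]
    rw [show (-(k - 1) - 1 : ℤ) = -k by ring]
  have s1 := summable_green hA hχ fun k => (R ^ (-k)) x
  have s2 : Summable fun k : ℤ => T (A (k - 1) (χ ((R ^ (-k)) x))) := by
    have := (Equiv.subRight (1 : ℤ)).summable_iff.2
      (summable_green hA hχ fun k => (R ^ (-k - 1)) x)
    refine (this.mapL (T : E →L[ℂ] E)).congr fun k => ?_
    simp only [Function.comp_apply, Equiv.subRight_apply, ContinuousLinearEquiv.coe_coe]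
    rw [show (-(k - 1) - 1 : ℤ) = -k by ring]
  rw [← sub_eq_iff_eq_add', e1, e2, ← s1.tsum_sub s2, tsum_eq_single 0]
  · rw [hA0]; simp
  · intro k hk
    rw [hAk k hk, sub_self]

/-- An invertible operator having a summable Green kernel is strongly structurally stable. -/
theorem stronglyStructurallyStable_of_summable_green [CompleteSpace E] {T : E ≃L[ℂ] E}
    (hA : Summable fun k => ‖A k‖) (hA0 : ∀ v, A 0 v = v + T (A (-1) v))
    (hAk : ∀ k ≠ 0, ∀ v, A k v = T (A (k - 1) v)) : StronglyStructurallyStable T := by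
  intro γ hγ
  set M : ℝ := ∑' k, ‖A k‖ with hM
  have hM0 : 0 ≤ M := tsum_nonneg fun k => norm_nonneg _
  set N : ℝ := ‖(T.symm : E →L[ℂ] E)‖ with hN
  have hN0 : 0 ≤ N := norm_nonneg _
  obtain ⟨ε, hε, hεM, hεγ, hεN⟩ : ∃ ε : ℝ, 0 < ε ∧ M * ε < 1 ∧ M * ε ≤ γ ∧ N * ε < 1 := by
    refine ⟨min 1 γ / (M + N + 1), by positivity, ?_, ?_, ?_⟩
    · rw [← mul_div_assoc, div_lt_one (by positivity)]
      nlinarith [min_le_left 1 γ]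
    · rw [← mul_div_assoc, div_le_iff₀ (by positivity)]
      nlinarith [min_le_right 1 γ]
    · rw [← mul_div_assoc, div_lt_one (by positivity)]
      nlinarith [min_le_left 1 γ]
  refine ⟨ε, hε, fun φ hφc hφb hφL => ?_⟩
  have hφL' : ∀ x y, ‖φ x - φ y‖ ≤ ε * ‖x - y‖ := fun x y => by
    simpa [Real.coe_toNNReal _ hε.le] using hφL.norm_sub_le x y
  -- the perturbed map is a homeomorphism
  obtain ⟨S, hS⟩ : ∃ S : E ≃ₜ E, ∀ x, S x = T x + φ x := by
    have happ : ApproximatesLinearOn (fun x => T x + φ x) (T : E →L[ℂ] E) univ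
        (Real.toNNReal ε) := by
      intro x _ y _
      rw [Real.coe_toNNReal _ hε.le]
      convert hφL' x y using 2
      simp only [ContinuousLinearEquiv.coe_coe, map_sub]
      abel
    refine ⟨happ.toHomeomorph _ ?_, fun x => rfl⟩
    rcases subsingleton_or_nontrivial E with h | h
    · exact Or.inl h
    · right
      have hNpos : 0 < N := T.norm_symm_pos
      rw [← NNReal.coe_lt_coe, Real.coe_toNNReal _ hε.le]
      push_cast
      rw [lt_inv_comm₀ hε hNpos]
      rwa [← one_div, lt_div_iff₀ hε]
  -- the conjugacy, as the fixed point of a contraction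
  obtain ⟨g, hg⟩ : ∃ g : BoundedContinuousFunction E E,
      ∀ x, greenSum A T.toHomeomorph (fun y => φ (y + g y)) x = g x := by
    let Φ : BoundedContinuousFunction E E → BoundedContinuousFunction E E := fun g =>
      BoundedContinuousFunction.ofNormedAddCommGroup
        (greenSum A T.toHomeomorph (fun y => φ (y + g y)))
        (continuous_greenSum hA (fun y => hφb (y + g y))
          (hφc.comp (continuous_id.add g.continuous))) (M * ε)
        (norm_greenSum_le hA fun y => hφb (y + g y))
    have hΦ : ContractingWith (Real.toNNReal (M * ε)) Φ := by
      refine ⟨by rw [← NNReal.coe_lt_coe, Real.coe_toNNReal _ (by positivity)]; simpa using hεM,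
        LipschitzWith.of_dist_le_mul fun g g' => ?_⟩
      rw [Real.coe_toNNReal _ (by positivity),
        BoundedContinuousFunction.dist_le (by positivity)]
      intro x
      rw [dist_eq_norm, mul_assoc]
      change ‖greenSum A T.toHomeomorph (fun y => φ (y + g y)) x -
        greenSum A T.toHomeomorph (fun y => φ (y + g' y)) x‖ ≤ _
      rw [greenSum_sub hA (fun y => hφb (y + g y)) (fun y => hφb (y + g' y))]
      refine norm_greenSum_le hA (fun y => (hφL' _ _).trans ?_) x
      gcongr
      rw [add_sub_add_left_eq_sub, ← dist_eq_norm]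
      exact BoundedContinuousFunction.dist_coe_le_dist y
    exact ⟨hΦ.fixedPoint, fun x => DFunLike.congr_fun hΦ.fixedPoint_isFixedPt x⟩
  have hgb : ∀ x, ‖g x‖ ≤ M * ε := fun x => by
    rw [← hg]; exact norm_greenSum_le hA (fun y => hφb _) x
  have hconj : ∀ x, T x + g (T x) = S (x + g x) := fun x => by
    have := greenSum_apply_map (R := T.toHomeomorph) hA hA0 hAk (fun y => hφb (y + g y)) x
    rw [hg, hg] at this
    rw [hS, map_add, add_assoc, ← this]
    rfl
  -- the inverse conjugacy
  set G : E → E := greenSum A S φ with hG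
  have hGb : ∀ x, ‖G x‖ ≤ M * ε := norm_greenSum_le hA hφb
  have hconj' : ∀ x, S x - G (S x) = T (x - G x) := fun x => by
    rw [hG, greenSum_apply_map hA hA0 hAk hφb x, hS, map_sub]
    abel
  have hleft : ∀ x, G (x + g x) = g x := fun x => by
    have := greenSum_semiconj (A := A) (χ := φ) (R := T.toHomeomorph)
      (h := fun y => y + g y) hconj x
    rwa [hg] at this
  have hright : ∀ x, g (x - G x) = G x := by
    let w : E → E := fun x => g (x - G x) - G x
    have hw : ∀ x, w x = greenSum A S (fun z => φ (z + w z) - φ z) x := fun x => by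
      have h1 : g (x - G x) = greenSum A S (fun z => φ (z + w z)) x := by
        rw [← hg, greenSum_semiconj (R := S) (S := T.toHomeomorph)
          (h := fun z => z - G z) hconj' x]
        congr 1
        ext z
        congr 1
        simp only [w]
        abel
      rw [← greenSum_sub hA (fun z => hφb _) hφb, ← h1]
    have hwn : ∀ n : ℕ, ∀ x, ‖w x‖ ≤ (M * ε) ^ n * (M * ε + M * ε) := by
      intro n
      induction n with
      | zero =>
        intro x
        rw [pow_zero, one_mul]
        exact (norm_sub_le _ _).trans (add_le_add (hgb _) (hGb _))
      | succ n ih =>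
        intro x
        rw [hw x, pow_succ', mul_assoc, mul_assoc]
        refine norm_greenSum_le hA (fun z => (hφL' _ _).trans ?_) x
        rw [add_sub_cancel_left]
        gcongr
        exact ih z
    intro x
    have hlim : Tendsto (fun n : ℕ => (M * ε) ^ n * (M * ε + M * ε)) atTop (nhds 0) := by
      simpa using (tendsto_pow_atTop_nhds_zero_of_lt_one (by positivity) hεM).mul_const
        (M * ε + M * ε)
    exact sub_eq_zero.1 (norm_le_zero_iff.1 (ge_of_tendsto' hlim fun n => hwn n x))
  refine ⟨⟨⟨fun x => x + g x, fun x => x - G x, fun x => ?_, fun x => ?_⟩,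
    continuous_id.add g.continuous, continuous_id.sub (continuous_greenSum hA hφb hφc)⟩,
    fun x => ?_, fun x => ?_⟩
  · simp only [hleft, add_sub_cancel_right]
  · simp only [hright, sub_add_cancel]
  · exact (hconj x).trans (hS _)
  · change ‖x + g x - x‖ ≤ γ
    rw [add_sub_cancel_left]
    exact (hgb x).trans hεγ

end GreenKernel
lemma exists_int_antidifference (d : ℤ → ℝ) : ∃ H : ℤ → ℝ, ∀ n, H (n + 1) = H n + d (n + 1) := by
  refine ⟨fun n => match n with
    | Int.ofNat n => ∑ i ∈ Finset.range n, d (i + 1)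
    | Int.negSucc n => -∑ i ∈ Finset.range (n + 1), d (-i), fun n => ?_⟩
  match n with
  | Int.ofNat n => exact Finset.sum_range_succ (fun i : ℕ => d (i + 1)) n
  | Int.negSucc 0 => simp
  | Int.negSucc (n + 1) =>
    have h : Int.negSucc (n + 1) + 1 = Int.negSucc n := by
      rw [Int.negSucc_eq, Int.negSucc_eq]; push_cast; ring
    rw [h]
    simp only [Finset.sum_range_succ _ (n + 1), Int.negSucc_eq, neg_add]
    push_cast
    ring_nf

/-- A positive sequence whose primitives are controlled by the sequence itself grows
exponentially to the right on some set of indices, and to the left on the complement. -/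
lemma exists_exponential_dichotomy {b H : ℤ → ℝ} {δ C L : ℝ} (hb : ∀ n, 0 < b n) (hδ : 0 < δ)
    (hH : ∀ n, H (n + 1) = H n + δ * b (n + 1))
    (hC : ∀ n m, |H n - H m| ≤ C * (b n + b m)) (hL : ∀ n, b (n + 1) ≤ L * b n) :
    ∃ (S : Set ℤ) (q D : ℝ), 0 < q ∧ q < 1 ∧ 0 ≤ D ∧
      (∀ n ∈ S, ∀ k : ℕ, b n ≤ D * q ^ k * b (n + k)) ∧
      (∀ n ∉ S, ∀ k : ℕ, b n ≤ D * q ^ k * b (n - k)) := by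
  obtain ⟨m, hm⟩ : ∃ m, ∀ n, |H n - m| ≤ C * b n := by
    have hle : ∀ n k, H n - C * b n ≤ H k + C * b k := fun n k => by
      have := le_abs_self (H n - H k)
      linarith [hC n k]
    have hbdd : BddAbove (range fun n => H n - C * b n) :=
      ⟨H 0 + C * b 0, by rintro _ ⟨n, rfl⟩; exact hle n 0⟩
    refine ⟨⨆ n, (H n - C * b n), fun n => abs_le.2 ⟨?_, ?_⟩⟩
    · linarith [ciSup_le fun k => hle k n]
    · linarith [le_ciSup hbdd n]
  obtain ⟨F, hF1, hF⟩ : ∃ F : ℝ, 1 ≤ F ∧ ∀ n, |(H n - m) / δ| ≤ F * b n := by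
    refine ⟨max 1 (C / δ), le_max_left _ _, fun n => ?_⟩
    rw [abs_div, abs_of_pos hδ, div_le_iff₀ hδ]
    refine (hm n).trans ?_
    have := mul_le_mul_of_nonneg_right (le_max_right 1 (C / δ)) (mul_pos (hb n) hδ).le
    refine le_trans (le_of_eq ?_) (this.trans_eq (by ring))
    field_simp
  set η : ℤ → ℝ := fun n => (H n - m) / δ with hη
  have hstep : ∀ n, η n = η (n - 1) + b n := fun n => by
    have := hH (n - 1)
    rw [sub_add_cancel] at this
    simp only [hη, this]
    field_simp
    ring
  have hup : ∀ n, η n ≤ F * b n := fun n => (abs_le.1 (hF n)).2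
  have hlo : ∀ n, -η n ≤ F * b n := fun n => by linarith [(abs_le.1 (hF n)).1]
  set q : ℝ := F / (F + 1) with hq
  have hq0 : 0 < q := by positivity
  have hqF : F = q * (F + 1) := by rw [hq]; field_simp
  have hpos : ∀ n, ∀ k : ℕ, 0 ≤ η n → η n ≤ q ^ k * η (n + k) := by
    intro n k hn
    induction k with
    | zero => simp
    | succ k ih =>
      refine ih.trans ?_
      rw [pow_succ, mul_assoc]
      gcongr
      have h1 := hstep (n + (k + 1 : ℕ))
      have h2 := hup (n + (k + 1 : ℕ))
      have h3 := hb (n + (k + 1 : ℕ))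
      rw [show n + ((k + 1 : ℕ) : ℤ) - 1 = n + k by push_cast; ring] at h1
      rw [hq, div_mul_eq_mul_div, le_div_iff₀ (by positivity)]
      nlinarith
  have hneg : ∀ n, ∀ k : ℕ, -η n ≤ q ^ k * -η (n - k) := by
    intro n k
    induction k with
    | zero => simp
    | succ k ih =>
      refine ih.trans ?_
      rw [pow_succ, mul_assoc]
      gcongr
      have h1 := hstep (n - k)
      have h2 := hlo (n - k)
      rw [show n - (k : ℤ) - 1 = n - (k + 1 : ℕ) by push_cast; ring] at h1
      rw [hq, div_mul_eq_mul_div, le_div_iff₀ (by positivity)]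
      nlinarith
  have hnegb : ∀ n, η n ≤ 0 → ∀ k : ℕ, b n ≤ (F + 1) * q ^ k * b (n - k) := by
    intro n hn k
    have h1 := hstep n
    have h2 := hneg (n - 1) k
    have h3 := hstep (n - k)
    have h4 := hlo (n - k)
    rw [show n - 1 - (k : ℤ) = n - k - 1 by ring] at h2
    calc b n ≤ q ^ k * -η (n - k - 1) := by linarith
      _ ≤ q ^ k * ((F + 1) * b (n - k)) := by gcongr; linarith
      _ = _ := by ring
  have hL0 : 0 < L := pos_of_mul_pos_left ((hb _).trans_le (hL 0)) (hb 0).le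
  refine ⟨{n | 0 ≤ η (n - 1)}, q, F + L * (F + 1) ^ 2 + 1, hq0, ?_, by positivity, ?_, ?_⟩
  · rw [hq, div_lt_one (by positivity)]; linarith
  · intro n hn k
    have h1 := hstep n
    have hn' : 0 ≤ η (n - 1) := hn
    have h0 : 0 ≤ q ^ k * b (n + k) := mul_nonneg (by positivity) (hb _).le
    calc b n ≤ η n := by linarith
      _ ≤ q ^ k * η (n + k) := hpos n k (by linarith [hb n])
      _ ≤ q ^ k * (F * b (n + k)) := by gcongr; exact hup _
      _ = F * (q ^ k * b (n + k)) := by ring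
      _ ≤ (F + L * (F + 1) ^ 2 + 1) * (q ^ k * b (n + k)) := by
        gcongr
        nlinarith [mul_pos hL0 (show 0 < (F + 1) ^ 2 by positivity)]
      _ = _ := by ring
  · intro n hn k
    have hn' : η (n - 1) < 0 := not_le.1 hn
    cases k with
    | zero =>
      have hbn := hb n
      simp only [pow_zero, Nat.cast_zero, sub_zero, mul_one]
      have : 0 ≤ (F + L * (F + 1) ^ 2) * b n := by positivity
      linarith
    | succ k =>
      have h1 := hnegb (n - 1) hn'.le k
      have h2 := hL (n - 1)
      rw [sub_add_cancel] at h2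
      rw [show n - 1 - (k : ℤ) = n - (k + 1 : ℕ) by push_cast; ring] at h1
      have h0 : 0 ≤ q ^ (k + 1) * b (n - (k + 1 : ℕ)) := mul_nonneg (by positivity) (hb _).le
      calc b n ≤ L * ((F + 1) * q ^ k * b (n - (k + 1 : ℕ))) := h2.trans (by gcongr)
        _ = L * (F + 1) * 1 * q ^ k * b (n - (k + 1 : ℕ)) := by ring
        _ ≤ L * (F + 1) * (q * (F + 1)) * q ^ k * b (n - (k + 1 : ℕ)) := by
          have := (hb (n - (k + 1 : ℕ))).le
          gcongr
          exact hqF ▸ hF1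
        _ = L * (F + 1) ^ 2 * (q ^ (k + 1) * b (n - (k + 1 : ℕ))) := by ring
        _ ≤ (F + L * (F + 1) ^ 2 + 1) * (q ^ (k + 1) * b (n - (k + 1 : ℕ))) := by
          gcongr
          linarith
        _ = _ := by ring

section IndicatorOperator

variable {X : Type*} [MeasurableSpace X] {μ : Measure X} {p : ℝ≥0∞}

/-- The product of an element of `Lp` with the indicator function of a measurable set. -/
noncomputable def lpIndicator (A : Set X) (hA : MeasurableSet A) (φ : Lp ℂ p μ) : Lp ℂ p μ :=
  MemLp.toLp (A.indicator φ) ((Lp.memLp φ).indicator hA)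

lemma coeFn_lpIndicator (A : Set X) (hA : MeasurableSet A) (φ : Lp ℂ p μ) :
    lpIndicator A hA φ =ᵐ[μ] A.indicator φ :=
  MemLp.coeFn_toLp _

lemma lpIndicator_add (A : Set X) (hA : MeasurableSet A) (φ ψ : Lp ℂ p μ) :
    lpIndicator A hA (φ + ψ) = lpIndicator A hA φ + lpIndicator A hA ψ := by
  refine Lp.ext ?_
  filter_upwards [coeFn_lpIndicator A hA (φ + ψ), coeFn_lpIndicator A hA φ,
    coeFn_lpIndicator A hA ψ, Lp.coeFn_add (lpIndicator A hA φ) (lpIndicator A hA ψ),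
    Lp.coeFn_add φ ψ] with x h1 h2 h3 h4 h5
  rw [h1, h4, Pi.add_apply, h2, h3]
  by_cases hx : x ∈ A
  · simp only [indicator_of_mem hx, h5, Pi.add_apply]
  · simp only [indicator_of_notMem hx, add_zero]

lemma lpIndicator_smul (A : Set X) (hA : MeasurableSet A) (a : ℂ) (φ : Lp ℂ p μ) :
    lpIndicator A hA (a • φ) = a • lpIndicator A hA φ := by
  refine Lp.ext ?_
  filter_upwards [coeFn_lpIndicator A hA (a • φ), coeFn_lpIndicator A hA φ,
    Lp.coeFn_smul a (lpIndicator A hA φ), Lp.coeFn_smul a φ] with x h1 h2 h3 h4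
  rw [h1, h3, Pi.smul_apply, h2]
  by_cases hx : x ∈ A <;> simp [hx, h4]

lemma norm_lpIndicator_le (A : Set X) (hA : MeasurableSet A) (φ : Lp ℂ p μ) :
    ‖lpIndicator A hA φ‖ ≤ 1 * ‖φ‖ := by
  rw [one_mul, lpIndicator, Lp.norm_toLp]
  exact ENNReal.toReal_mono (Lp.eLpNorm_ne_top φ) (eLpNorm_indicator_le _)

variable [Fact (1 ≤ p)]

/-- Multiplication by the indicator function of a measurable set, as an operator on `Lp`. -/
noncomputable def indicatorCLM (A : Set X) (hA : MeasurableSet A) : Lp ℂ p μ →L[ℂ] Lp ℂ p μ :=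
  LinearMap.mkContinuous (IsLinearMap.mk' (lpIndicator A hA)
    ⟨lpIndicator_add A hA, lpIndicator_smul A hA⟩) 1 (norm_lpIndicator_le A hA)

lemma coeFn_indicatorCLM (A : Set X) (hA : MeasurableSet A) (φ : Lp ℂ p μ) :
    indicatorCLM A hA φ =ᵐ[μ] A.indicator φ :=
  coeFn_lpIndicator A hA φ

lemma indicatorCLM_add_compl {A B : Set X} (hA : MeasurableSet A) (hB : MeasurableSet B)
    (hAB : Aᶜ = B) (φ : Lp ℂ p μ) : indicatorCLM A hA φ + indicatorCLM B hB φ = φ := by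
  refine Lp.ext ?_
  filter_upwards [Lp.coeFn_add (indicatorCLM A hA φ) (indicatorCLM B hB φ),
    coeFn_indicatorCLM A hA φ, coeFn_indicatorCLM B hB φ] with x h1 h2 h3
  rw [h1, Pi.add_apply, h2, h3, ← hAB, indicator_self_add_compl_apply]

lemma indicatorCLM_indicatorConstLp {A : Set X} (hA : MeasurableSet A) (hA' : μ A ≠ ⊤) (a : ℂ) :
    indicatorCLM A hA (indicatorConstLp p hA hA' a) = indicatorConstLp p hA hA' a := by
  refine Lp.ext ?_
  filter_upwards [coeFn_indicatorCLM A hA (indicatorConstLp p hA hA' a),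
    indicatorConstLp_coeFn (p := p) (hs := hA) (hμs := hA') (c := a)] with x h1 h2
  rw [h1]
  by_cases hx : x ∈ A <;> simp [hx, h2]

end IndicatorOperator

section CompositionOperator

variable {X : Type*} [MeasurableSpace X] {μ : Measure X} {e : Equiv.Perm X}

lemma measurable_perm_zpow (he : Measurable e) (he' : Measurable e.symm) (n : ℤ) :
    Measurable (e ^ n : Equiv.Perm X) := by
  induction n with
  | zero => exact measurable_id
  | succ n ih => rw [zpow_add_one]; exact ih.comp he
  | pred n ih => rw [zpow_sub_one]; exact ih.comp he'

lemma exists_measure_preimage_perm_zpow_le (he : Measurable e) (he' : Measurable e.symm)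
    {c c' : ℝ≥0∞} (hcT : c ≠ ⊤) (hc'T : c' ≠ ⊤)
    (hb : ∀ B : Set X, MeasurableSet B → μ (⇑e ⁻¹' B) ≤ c * μ B)
    (hb' : ∀ B : Set X, MeasurableSet B → μ (⇑e '' B) ≤ c' * μ B) (n : ℤ) :
    ∃ C : ℝ≥0∞, C ≠ ⊤ ∧ ∀ B, MeasurableSet B → μ (⇑(e ^ n) ⁻¹' B) ≤ C * μ B := by
  induction n with
  | zero => exact ⟨1, by simp, fun B _ => by simp⟩
  | succ n ih =>
    obtain ⟨C, hC, h⟩ := ih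
    refine ⟨c * C, ENNReal.mul_ne_top hcT hC, fun B hB => ?_⟩
    rw [zpow_add_one, Equiv.Perm.coe_mul, preimage_comp, mul_assoc]
    exact (hb _ (measurable_perm_zpow he he' _ hB)).trans (by gcongr; exact h B hB)
  | pred n ih =>
    obtain ⟨C, hC, h⟩ := ih
    refine ⟨c' * C, ENNReal.mul_ne_top hc'T hC, fun B hB => ?_⟩
    rw [zpow_sub_one, Equiv.Perm.coe_mul, preimage_comp, mul_assoc]
    have : ⇑(e⁻¹ : Equiv.Perm X) ⁻¹' (⇑(e ^ (-n : ℤ)) ⁻¹' B) = e '' (⇑(e ^ (-n : ℤ)) ⁻¹' B) :=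
      (e.image_eq_preimage_symm _).symm
    rw [this]
    exact (hb' _ (measurable_perm_zpow he he' _ hB)).trans (by gcongr; exact h B hB)

lemma quasiMeasurePreserving_perm_zpow (he : Measurable e) (he' : Measurable e.symm)
    {c c' : ℝ≥0∞} (hcT : c ≠ ⊤) (hc'T : c' ≠ ⊤)
    (hb : ∀ B : Set X, MeasurableSet B → μ (⇑e ⁻¹' B) ≤ c * μ B)
    (hb' : ∀ B : Set X, MeasurableSet B → μ (⇑e '' B) ≤ c' * μ B) (n : ℤ) :
    Measure.QuasiMeasurePreserving (e ^ n : Equiv.Perm X) μ μ := by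
  obtain ⟨C, -, h⟩ := exists_measure_preimage_perm_zpow_le he he' hcT hc'T hb hb' n
  have hm := measurable_perm_zpow he he' n
  refine ⟨hm, Measure.AbsolutelyContinuous.mk fun B hB hB0 => ?_⟩
  rw [Measure.map_apply hm hB]
  simpa [hB0] using h B hB

variable {p : ℝ≥0∞} [Fact (1 ≤ p)] {T : Lp ℂ p μ ≃L[ℂ] Lp ℂ p μ}

lemma coeFn_zpow_composition
    (hq : ∀ n : ℤ, Measure.QuasiMeasurePreserving (e ^ n : Equiv.Perm X) μ μ)
    (hT : ∀ φ : Lp ℂ p μ, (T φ : X → ℂ) =ᵐ[μ] fun x => φ (e x)) (n : ℤ) (φ : Lp ℂ p μ) :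
    ((T ^ n) φ : X → ℂ) =ᵐ[μ] φ ∘ (e ^ n : Equiv.Perm X) := by
  induction n generalizing φ with
  | zero => exact EventuallyEq.rfl
  | succ n ih =>
    rw [add_comm, zpow_add, zpow_one, add_comm, zpow_add_one]
    exact (hT ((T ^ (n : ℤ)) φ)).trans ((by simpa using hq 1 :
      Measure.QuasiMeasurePreserving e μ μ).ae_eq_comp (ih φ))
  | pred n ih =>
    have h1 : ((T ^ (-n : ℤ)) φ : X → ℂ) =ᵐ[μ] (T ^ (-n - 1 : ℤ)) φ ∘ e := by
      have h := hT ((T ^ (-n - 1 : ℤ)) φ)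
      have h2 : T ((T ^ (-n - 1 : ℤ)) φ) = (T ^ (-n : ℤ)) φ := by
        conv_rhs => rw [show (-n : ℤ) = 1 + (-n - 1) by ring, zpow_add, zpow_one]
        rfl
      rwa [h2] at h
    have h3 := (hq (-1)).ae_eq_comp (h1.symm.trans (ih φ))
    have h4 : ((T ^ (-n - 1 : ℤ)) φ : X → ℂ) ∘ e ∘ ⇑(e ^ (-1 : ℤ)) = (T ^ (-n - 1 : ℤ)) φ := by
      ext x; simp
    rw [Function.comp_assoc, h4, Function.comp_assoc, ← Equiv.Perm.coe_mul, ← zpow_add] at h3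
    exact h3

lemma norm_zpow_indicatorCLM_le
    (hq : ∀ n : ℤ, Measure.QuasiMeasurePreserving (e ^ n : Equiv.Perm X) μ μ)
    (hT : ∀ φ : Lp ℂ p μ, (T φ : X → ℂ) =ᵐ[μ] fun x => φ (e x)) {A : Set X}
    (hA : MeasurableSet A) {k : ℤ} {D : ℝ≥0∞} (hD : D ≠ ⊤)
    (h : ∀ B, MeasurableSet B → μ (⇑(e ^ k) ⁻¹' (B ∩ A)) ≤ D * μ (B ∩ A)) (φ : Lp ℂ p μ) :
    ‖(T ^ k) (indicatorCLM A hA φ)‖ ≤ (D ^ (1 / p).toReal).toReal * ‖φ‖ := by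
  have hle : (μ.map ⇑(e ^ k)).restrict A ≤ D • μ.restrict A := by
    refine Measure.le_iff.2 fun B hB => ?_
    rw [Measure.restrict_apply hB, Measure.map_apply (hq k).measurable (hB.inter hA),
      Measure.smul_apply, Measure.restrict_apply hB]
    exact h B hB
  have hae : ((T ^ k) (indicatorCLM A hA φ) : X → ℂ) =ᵐ[μ] A.indicator φ ∘ ⇑(e ^ k) :=
    (coeFn_zpow_composition hq hT k _).trans ((hq k).ae_eq_comp (coeFn_indicatorCLM A hA φ))
  rw [Lp.norm_def, Lp.norm_def, ← ENNReal.toReal_mul]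
  refine ENNReal.toReal_mono (ENNReal.mul_ne_top
    (ENNReal.rpow_ne_top_of_nonneg ENNReal.toReal_nonneg hD) (Lp.eLpNorm_ne_top φ)) ?_
  rw [eLpNorm_congr_ae hae, ← eLpNorm_map_measure
    ((Lp.stronglyMeasurable φ).indicator hA).aestronglyMeasurable (hq k).measurable.aemeasurable,
    eLpNorm_indicator_eq_eLpNorm_restrict hA]
  refine (eLpNorm_le_of_measure_le_smul hle).trans ?_
  rw [smul_eq_mul]
  gcongr
  exact Measure.restrict_le_self

lemma zpow_indicatorConstLp
    (hq : ∀ n : ℤ, Measure.QuasiMeasurePreserving (e ^ n : Equiv.Perm X) μ μ)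
    (hT : ∀ φ : Lp ℂ p μ, (T φ : X → ℂ) =ᵐ[μ] fun x => φ (e x)) {A B : Set X}
    (hA : MeasurableSet A) (hA' : μ A ≠ ⊤) (hB : MeasurableSet B) (hB' : μ B ≠ ⊤) {k : ℤ}
    (hAB : ⇑(e ^ k) ⁻¹' A = B) (a : ℂ) :
    (T ^ k) (indicatorConstLp p hA hA' a) = indicatorConstLp p hB hB' a := by
  refine Lp.ext ?_
  refine (coeFn_zpow_composition hq hT k _).trans (((hq k).ae_eq_comp
    indicatorConstLp_coeFn).trans (EventuallyEq.trans (Eq.eventuallyEq ?_)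
      indicatorConstLp_coeFn.symm))
  rw [← hAB]
  rfl

lemma indicatorCLM_zpow
    (hq : ∀ n : ℤ, Measure.QuasiMeasurePreserving (e ^ n : Equiv.Perm X) μ μ)
    (hT : ∀ φ : Lp ℂ p μ, (T φ : X → ℂ) =ᵐ[μ] fun x => φ (e x)) {A B : Set X}
    (hA : MeasurableSet A) (hB : MeasurableSet B) {k : ℤ}
    (hAB : ⇑(e ^ k) ⁻¹' A = B) (φ : Lp ℂ p μ) :
    indicatorCLM B hB ((T ^ k) φ) = (T ^ k) (indicatorCLM A hA φ) := by
  refine Lp.ext ?_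
  filter_upwards [coeFn_indicatorCLM B hB ((T ^ k) φ), coeFn_zpow_composition hq hT k φ,
    coeFn_zpow_composition hq hT k (indicatorCLM A hA φ),
    (hq k).ae_eq_comp (coeFn_indicatorCLM A hA φ)] with x h1 h2 h3 h4
  rw [h1, h3, h4, ← hAB]
  by_cases hx : (e ^ k) x ∈ A <;> simp [hx, h2]

end CompositionOperator

lemma preimage_perm_zpow_preimage {X : Type*} {e : Equiv.Perm X} (n k : ℤ)
    (B : Set X) :
    ⇑(e ^ k) ⁻¹' (⇑(e ^ n) ⁻¹' B) = ⇑(e ^ (n + k)) ⁻¹' B := by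
  rw [← preimage_comp, ← Equiv.Perm.coe_mul, ← zpow_add]

lemma image_perm_zpow_eq_preimage {X : Type*} {e : Equiv.Perm X} (n : ℤ)
    (B : Set X) :
    ⇑(e ^ n) '' B = ⇑(e ^ (-n)) ⁻¹' B := by
  rw [zpow_neg]; exact Equiv.image_eq_preimage_symm _ _

section BoundedDistortion

variable {X : Type*} [MeasurableSpace X] {μ : Measure X} {e : Equiv.Perm X} {W : Set X}
  {K : ℝ≥0∞}

/-- Bounded distortion, transported to a level `(e ^ n) ⁻¹' W` of the dissipative tower. -/
lemma measure_preimage_mul_le_of_boundedDistortion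
    (hm : ∀ n : ℤ, Measurable (e ^ n : Equiv.Perm X)) (hW0 : 0 < μ W) (hWfin : μ W ≠ ⊤)
    (hK0 : 0 < K) (hKT : K ≠ ⊤)
    (hbd : ∀ (k : ℤ) (B : Set X), MeasurableSet B → B ⊆ W →
        K⁻¹ * (μ (⇑(e ^ k) '' W) * μ B) ≤ μ (⇑(e ^ k) '' B) * μ W ∧
        μ (⇑(e ^ k) '' B) * μ W ≤ K * (μ (⇑(e ^ k) '' W) * μ B))
    (n k : ℤ) {B : Set X} (hB : MeasurableSet B) (hBW : B ⊆ ⇑(e ^ n) ⁻¹' W) :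
    μ (⇑(e ^ k) ⁻¹' B) * μ (⇑(e ^ n) ⁻¹' W) ≤ K ^ 2 * μ (⇑(e ^ (n + k)) ⁻¹' W) * μ B := by
  set B' : Set X := ⇑(e ^ (-n)) ⁻¹' B with hB'
  have hB'm : MeasurableSet B' := hm _ hB
  have hB'W : B' ⊆ W := by
    refine (preimage_mono hBW).trans ?_
    rw [preimage_perm_zpow_preimage]
    simp
  have hBB' : ⇑(e ^ n) ⁻¹' B' = B := by
    rw [hB', preimage_perm_zpow_preimage]; simp
  have h1 := (hbd (-(n + k)) B' hB'm hB'W).2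
  have h2 := (hbd (-n) B' hB'm hB'W).1
  simp only [image_perm_zpow_eq_preimage, neg_neg] at h1 h2
  rw [← preimage_perm_zpow_preimage n k B', hBB'] at h1
  rw [hBB'] at h2
  rw [← ENNReal.mul_le_mul_iff_left hW0.ne' hWfin]
  have h3 : μ (⇑(e ^ n) ⁻¹' W) * μ B' ≤ K * (μ B * μ W) := by
    calc μ (⇑(e ^ n) ⁻¹' W) * μ B' = K * (K⁻¹ * (μ (⇑(e ^ n) ⁻¹' W) * μ B')) := by
          rw [← mul_assoc, ENNReal.mul_inv_cancel hK0.ne' hKT, one_mul]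
      _ ≤ _ := by gcongr
  calc μ (⇑(e ^ k) ⁻¹' B) * μ (⇑(e ^ n) ⁻¹' W) * μ W
      = μ (⇑(e ^ k) ⁻¹' B) * μ W * μ (⇑(e ^ n) ⁻¹' W) := by ring
    _ ≤ K * (μ (⇑(e ^ (n + k)) ⁻¹' W) * μ B') * μ (⇑(e ^ n) ⁻¹' W) := by gcongr
    _ = K * μ (⇑(e ^ (n + k)) ⁻¹' W) * (μ (⇑(e ^ n) ⁻¹' W) * μ B') := by ring
    _ ≤ K * μ (⇑(e ^ (n + k)) ⁻¹' W) * (K * (μ B * μ W)) := by gcongr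
    _ = _ := by ring

lemma measure_preimage_inter_iUnion_le {V : ℤ → Set X} (hV : ∀ n, MeasurableSet (V n))
    (hdisj : Pairwise (Function.onFun Disjoint V)) {g : X → X} {D : ℝ≥0∞} {S : Set ℤ}
    (h : ∀ n ∈ S, ∀ B, MeasurableSet B → B ⊆ V n → μ (g ⁻¹' B) ≤ D * μ B)
    {B : Set X} (hB : MeasurableSet B) :
    μ (g ⁻¹' (B ∩ ⋃ n ∈ S, V n)) ≤ D * μ (B ∩ ⋃ n ∈ S, V n) := by
  have hU : (B ∩ ⋃ n ∈ S, V n) = ⋃ n : S, B ∩ V n := by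
    rw [biUnion_eq_iUnion, inter_iUnion]
  rw [hU, preimage_iUnion, measure_iUnion (fun i j hij =>
    ((hdisj fun h => hij (Subtype.ext h)).mono inter_subset_right inter_subset_right))
    (fun n => hB.inter (hV n)), ← ENNReal.tsum_mul_left]
  exact (measure_iUnion_le _).trans
    (ENNReal.tsum_le_tsum fun n => h n n.2 _ (hB.inter (hV n)) inter_subset_right)

end BoundedDistortion

/-- An invertible operator that contracts the range of `P` in the future and the range of the
complementary operator `Q` in the past is strongly structurally stable. -/
theorem stronglyStructurallyStable_of_splitting {E : Type*} [NormedAddCommGroup E]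
    [NormedSpace ℂ E] [CompleteSpace E] {T : E ≃L[ℂ] E} (P Q : E →L[ℂ] E)
    (hPQ : ∀ v, P v + Q v = v) {q D : ℝ} (hq0 : 0 ≤ q) (hq1 : q < 1) (hD : 0 ≤ D)
    (hP : ∀ (k : ℕ) v, ‖(T ^ (k : ℤ)) (P v)‖ ≤ D * q ^ k * ‖v‖)
    (hQ : ∀ (k : ℕ) v, ‖(T ^ (-k : ℤ)) (Q v)‖ ≤ D * q ^ k * ‖v‖) :
    StronglyStructurallyStable T := by
  let A : ℤ → E →L[ℂ] E := fun k =>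
    if 0 ≤ k then ((T ^ k : E ≃L[ℂ] E) : E →L[ℂ] E) ∘L P
    else -(((T ^ k : E ≃L[ℂ] E) : E →L[ℂ] E) ∘L Q)
  have hApos : ∀ k : ℤ, 0 ≤ k → ∀ v, A k v = (T ^ k) (P v) := fun k hk v => by
    simp only [A, if_pos hk]; rfl
  have hAneg : ∀ k : ℤ, k < 0 → ∀ v, A k v = -(T ^ k) (Q v) := fun k hk v => by
    simp only [A, if_neg (not_le.2 hk)]; rfl
  have hT : ∀ (k : ℤ) v, T ((T ^ (k - 1)) v) = (T ^ k) v := fun k v => by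
    conv_rhs => rw [show k = 1 + (k - 1) by ring, zpow_add, zpow_one]
    rfl
  have hgeom : Summable fun k : ℕ => D * q ^ k :=
    (summable_geometric_of_lt_one hq0 hq1).mul_left D
  refine stronglyStructurallyStable_of_summable_green (A := A) ?_ ?_ ?_
  · refine Summable.of_nat_of_neg ?_ ?_
    · refine Summable.of_nonneg_of_le (fun _ => norm_nonneg _) (fun k => ?_) hgeom
      refine ContinuousLinearMap.opNorm_le_bound _ (by positivity) fun v => ?_
      rw [hApos _ (by positivity)]
      exact hP k v
    · rw [← summable_nat_add_iff 1]
      refine Summable.of_nonneg_of_le (fun _ => norm_nonneg _) (fun k => ?_)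
        ((summable_nat_add_iff 1).2 hgeom)
      refine ContinuousLinearMap.opNorm_le_bound _ (by positivity) fun v => ?_
      rw [hAneg _ (by push_cast; linarith [(Nat.cast_nonneg k : (0 : ℤ) ≤ k)]), norm_neg]
      exact hQ (k + 1) v
  · intro v
    rw [hApos 0 le_rfl, hAneg (-1) (by norm_num), map_neg]
    have := hT 0 (Q v)
    rw [zero_sub] at this
    rw [this, ← sub_eq_add_neg, eq_sub_iff_add_eq]
    exact hPQ v
  · intro k hk v
    rcases lt_or_gt_of_ne hk with h | h
    · rw [hAneg k h, hAneg (k - 1) (by linarith), map_neg, hT]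
    · rw [hApos k h.le, hApos (k - 1) (by linarith), hT]

/-- Corollary SC2: for a dissipative composition dynamical system of bounded
distortion generated by `W`, if `T_f` has the shadowing property then it is
strongly structurally stable. -/
theorem stmt_13
    {X : Type*} [MeasurableSpace X] (μ : MeasureTheory.Measure X) [MeasureTheory.SigmaFinite μ]
    (p : ℝ≥0∞) (hp1 : 1 ≤ p) (hpT : p ≠ ⊤)
    (e : Equiv.Perm X) (he : Measurable e) (he' : Measurable e.symm)
    (c c' : ℝ≥0∞) (hc : 0 < c) (hcT : c ≠ ⊤) (hc' : 0 < c') (hc'T : c' ≠ ⊤)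
    (hb : ∀ B : Set X, MeasurableSet B → μ (⇑e ⁻¹' B) ≤ c * μ B)
    (hb' : ∀ B : Set X, MeasurableSet B → μ (⇑e '' B) ≤ c' * μ B)
    (W : Set X) (hWm : MeasurableSet W) (hW0 : 0 < μ W) (hWfin : μ W ≠ ⊤)
    (hcover : (⋃ k : ℤ, ⇑(e ^ k) '' W) = Set.univ)
    (hdisj : Pairwise (fun k l : ℤ => Disjoint (⇑(e ^ k) '' W) (⇑(e ^ l) '' W)))
    (K : ℝ≥0∞) (hK0 : 0 < K) (hKT : K ≠ ⊤)
    (hbd : ∀ (k : ℤ) (B : Set X), MeasurableSet B → B ⊆ W →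
        K⁻¹ * (μ (⇑(e ^ k) '' W) * μ B) ≤ μ (⇑(e ^ k) '' B) * μ W ∧
        μ (⇑(e ^ k) '' B) * μ W ≤ K * (μ (⇑(e ^ k) '' W) * μ B))
    [Fact (1 ≤ p)]
    (T : MeasureTheory.Lp ℂ p μ ≃L[ℂ] MeasureTheory.Lp ℂ p μ)
    (hT : ∀ φ : MeasureTheory.Lp ℂ p μ, (T φ : X → ℂ) =ᵐ[μ] fun x => φ (e x))
    (hsh : HasShadowing T) :
    StronglyStructurallyStable T := by
  have hm := measurable_perm_zpow he he'
  have hq := quasiMeasurePreserving_perm_zpow he he' hcT hc'T hb hb'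
  have hp0 : p ≠ 0 := (zero_lt_one.trans_le hp1).ne'
  -- the levels of the tower
  let V : ℤ → Set X := fun n => ⇑(e ^ n) ⁻¹' W
  have hVm : ∀ n, MeasurableSet (V n) := fun n => hm n hWm
  have hVpre : ∀ n k, ⇑(e ^ k) ⁻¹' V n = V (n + k) := fun n k =>
    preimage_perm_zpow_preimage n k W
  have hVfin : ∀ n, μ (V n) ≠ ⊤ := fun n => by
    obtain ⟨C, hC, h⟩ := exists_measure_preimage_perm_zpow_le he he' hcT hc'T hb hb' n
    exact ne_top_of_le_ne_top (ENNReal.mul_ne_top hC hWfin) (h W hWm)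
  have hV0 : ∀ n, μ (V n) ≠ 0 := fun n h => by
    have := (hq (-n)).preimage_null h
    rw [hVpre] at this
    simp only [V, add_neg_cancel, zpow_zero] at this
    exact hW0.ne' this
  have hVdisj : Pairwise (Function.onFun Disjoint V) := fun n m hnm => by
    have := hdisj (neg_injective.ne hnm)
    simpa only [image_perm_zpow_eq_preimage, neg_neg] using this
  have hVcover : ∀ x, ∃ n, x ∈ V n := fun x => by
    obtain ⟨k, hk⟩ := mem_iUnion.1 (hcover.symm ▸ mem_univ x : x ∈ ⋃ k : ℤ, ⇑(e ^ k) '' W)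
    rw [image_perm_zpow_eq_preimage] at hk
    exact ⟨-k, hk⟩
  -- the indicator functions of the levels
  let χ : ℤ → Lp ℂ p μ := fun n => indicatorConstLp p (hVm n) (hVfin n) 1
  have hTχ : ∀ k n, (T ^ k) (χ n) = χ (n + k) := fun k n =>
    zpow_indicatorConstLp hq hT _ _ _ _ (hVpre n k) 1
  have hχ : ∀ n, ‖χ n‖ = (μ (V n)).toReal ^ (1 / p.toReal) := fun n => by
    rw [norm_indicatorConstLp hp0 hpT, norm_one, one_mul, measureReal_def]
  have hpr : 0 < p.toReal := ENNReal.toReal_pos hp0 hpT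
  have hχ0 : ∀ n, 0 < ‖χ n‖ := fun n => by
    rw [hχ]; exact Real.rpow_pos_of_pos (ENNReal.toReal_pos (hV0 n) (hVfin n)) _
  have hμχ : ∀ n, μ (V n) = ENNReal.ofReal ‖χ n‖ ^ p.toReal := fun n => by
    rw [hχ, ENNReal.ofReal_rpow_of_nonneg (by positivity) hpr.le,
      ← Real.rpow_mul ENNReal.toReal_nonneg, one_div_mul_cancel hpr.ne', Real.rpow_one,
      ENNReal.ofReal_toReal (hVfin n)]
  -- norm estimates on unions of levels
  have hAm : ∀ S : Set ℤ, MeasurableSet (⋃ n ∈ S, V n) := fun S =>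
    MeasurableSet.biUnion S.to_countable fun n _ => hVm n
  let κ : ℝ := ((K ^ 2) ^ (1 / p).toReal).toReal
  have hκ : 0 ≤ κ := ENNReal.toReal_nonneg
  have hnorm : ∀ (S : Set ℤ) (k : ℤ) (r : ℝ), 0 ≤ r → (∀ n ∈ S, ‖χ (n + k)‖ ≤ r * ‖χ n‖) →
      ∀ φ : Lp ℂ p μ, ‖(T ^ k) (indicatorCLM (⋃ n ∈ S, V n) (hAm S) φ)‖ ≤ κ * r * ‖φ‖ := by
    intro S k r hr h φ
    have hD : ((K ^ 2 * ENNReal.ofReal r ^ p.toReal) ^ (1 / p).toReal).toReal = κ * r := by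
      rw [ENNReal.mul_rpow_of_nonneg _ _ ENNReal.toReal_nonneg, ENNReal.toReal_mul,
        ← ENNReal.rpow_mul, ENNReal.toReal_div, ENNReal.toReal_one, mul_one_div_cancel hpr.ne',
        ENNReal.rpow_one, ENNReal.toReal_ofReal hr, ← ENNReal.toReal_one, ← ENNReal.toReal_div]
    rw [← hD]
    refine norm_zpow_indicatorCLM_le hq hT (hAm S) (ENNReal.mul_ne_top (by simp [hKT])
      (ENNReal.rpow_ne_top_of_nonneg hpr.le ENNReal.ofReal_ne_top))
      (fun B hB => measure_preimage_inter_iUnion_le hVm hVdisj (fun n hn B hB hBV => ?_) hB) φ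
    rw [← ENNReal.mul_le_mul_iff_left (hV0 n) (hVfin n)]
    refine (measure_preimage_mul_le_of_boundedDistortion hm hW0 hWfin hK0 hKT hbd n k hB
      hBV).trans ?_
    change K ^ 2 * μ (V (n + k)) * μ B ≤ _
    have h1 : μ (V (n + k)) ≤ ENNReal.ofReal r ^ p.toReal * μ (V n) := by
      rw [hμχ, hμχ n, ← ENNReal.mul_rpow_of_nonneg _ _ hpr.le, ← ENNReal.ofReal_mul hr]
      exact ENNReal.rpow_le_rpow (ENNReal.ofReal_le_ofReal (h n hn)) hpr.le
    calc K ^ 2 * μ (V (n + k)) * μ B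
        ≤ K ^ 2 * (ENNReal.ofReal r ^ p.toReal * μ (V n)) * μ B := by gcongr
      _ = _ := by ring
  -- a pseudotrajectory moving up the tower
  obtain ⟨δ, hδ, hshadow⟩ := hsh 1 one_pos
  obtain ⟨H, hH⟩ := exists_int_antidifference fun n => δ * ‖χ n‖⁻¹
  obtain ⟨y, hy⟩ := hshadow (fun n => (H n : ℂ) • χ n) fun n => by
    have h1 : T (χ n) = χ (n + 1) := by simpa using hTχ 1 n
    rw [map_smul, h1, ← sub_smul, norm_smul, ← Complex.ofReal_sub, Complex.norm_real, hH,
      sub_add_cancel_left, norm_neg, Real.norm_of_nonneg (by positivity),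
      inv_mul_cancel_right₀ (hχ0 _).ne']
  have hdist : ∀ n, ‖indicatorCLM (V 0) (hVm 0) y - (H n : ℂ) • χ 0‖ ≤
      κ * (‖χ 0‖ * ‖χ n‖⁻¹) := by
    intro n
    have hsing : ⋃ m ∈ ({n} : Set ℤ), V m = V n := biUnion_singleton _ _
    have hle := hnorm {n} (-n) (‖χ 0‖ * ‖χ n‖⁻¹) (by positivity)
      (by
        rintro _ rfl
        rw [add_neg_cancel, inv_mul_cancel_right₀ (hχ0 _).ne'])
      ((T ^ n) y - (H n : ℂ) • χ n)
    simp only [hsing] at hle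
    have hcomm : indicatorCLM (V n) (hVm n) ((T ^ n) y) =
        (T ^ n) (indicatorCLM (V 0) (hVm 0) y) :=
      indicatorCLM_zpow hq hT _ _ (by rw [hVpre, zero_add]) y
    have hχn : indicatorCLM (V n) (hVm n) (χ n) = χ n :=
      indicatorCLM_indicatorConstLp (hVm n) (hVfin n) 1
    have hinv : ∀ v, (T ^ (-n)) ((T ^ n) v) = v := fun v => by
      change (T ^ (-n) * T ^ n) v = v
      rw [← zpow_add, neg_add_cancel, zpow_zero]
      rfl
    rw [map_sub, map_sub, map_smul, map_smul, hcomm, hχn, hinv, hTχ, add_neg_cancel] at hle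
    exact hle.trans (mul_le_of_le_one_right (by positivity) (hy n).le)
  -- the resulting exponential dichotomy of the norms
  obtain ⟨S, q, D, hq0, hq1, hD, hS, hS'⟩ := exists_exponential_dichotomy
    (b := fun n => ‖χ n‖⁻¹) (H := H) (C := κ)
    (L := ‖((T ^ (-1 : ℤ) : Lp ℂ p μ ≃L[ℂ] Lp ℂ p μ) : Lp ℂ p μ →L[ℂ] Lp ℂ p μ)‖)
    (fun n => inv_pos.2 (hχ0 n)) hδ hH
    (fun n m => by
      have h1 : ‖((H n : ℂ) - H m) • χ 0‖ = |H n - H m| * ‖χ 0‖ := by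
        rw [norm_smul, ← Complex.ofReal_sub, Complex.norm_real, Real.norm_eq_abs]
      have h2 := norm_sub_le (indicatorCLM (V 0) (hVm 0) y - (H m : ℂ) • χ 0)
        (indicatorCLM (V 0) (hVm 0) y - (H n : ℂ) • χ 0)
      have h3 : indicatorCLM (V 0) (hVm 0) y - (H m : ℂ) • χ 0 -
          (indicatorCLM (V 0) (hVm 0) y - (H n : ℂ) • χ 0) = ((H n : ℂ) - H m) • χ 0 := by
        module
      rw [h3, h1] at h2
      refine le_of_mul_le_mul_right ?_ (hχ0 0)
      calc _ ≤ _ := h2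
        _ ≤ κ * (‖χ 0‖ * ‖χ m‖⁻¹) + κ * (‖χ 0‖ * ‖χ n‖⁻¹) := add_le_add (hdist m) (hdist n)
        _ = _ := by ring)
    (fun n => by
      have h := ContinuousLinearMap.le_opNorm
        ((T ^ (-1 : ℤ) : Lp ℂ p μ ≃L[ℂ] Lp ℂ p μ) : Lp ℂ p μ →L[ℂ] Lp ℂ p μ) (χ (n + 1))
      rw [ContinuousLinearEquiv.coe_coe, hTχ, add_neg_cancel_right] at h
      rw [← div_eq_mul_inv, inv_le_comm₀ (hχ0 _) (by
        exact div_pos (pos_of_mul_pos_left ((hχ0 n).trans_le h) (norm_nonneg _)) (hχ0 n)),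
        inv_div, div_le_iff₀ (pos_of_mul_pos_left ((hχ0 n).trans_le h) (norm_nonneg _)), mul_comm]
      exact h)
  have hcompl : (⋃ n ∈ S, V n)ᶜ = ⋃ n ∈ Sᶜ, V n := by
    ext x
    obtain ⟨n, hn⟩ := hVcover x
    have huniq : ∀ m, x ∈ V m → m = n := fun m hm => by
      by_contra hne
      exact disjoint_left.1 (hVdisj hne) hm hn
    have hmem : ∀ R : Set ℤ, x ∈ ⋃ n ∈ R, V n ↔ n ∈ R := fun R => by
      simp only [mem_iUnion, exists_prop]
      exact ⟨fun ⟨m, hmR, hm⟩ => huniq m hm ▸ hmR, fun h => ⟨n, h, hn⟩⟩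
    rw [mem_compl_iff, hmem, hmem, mem_compl_iff]
  have hratio : ∀ (n m : ℤ) (r : ℝ), ‖χ n‖⁻¹ ≤ r * ‖χ m‖⁻¹ → ‖χ m‖ ≤ r * ‖χ n‖ := by
    intro n m r h
    rwa [← div_eq_mul_inv, le_div_iff₀ (hχ0 m), inv_mul_le_iff₀ (hχ0 n), mul_comm] at h
  refine stronglyStructurallyStable_of_splitting (indicatorCLM _ (hAm S))
    (indicatorCLM _ (hAm Sᶜ)) (indicatorCLM_add_compl _ _ hcompl) hq0.le hq1
    (mul_nonneg hκ hD) (fun k v => ?_) (fun k v => ?_)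
  · rw [mul_assoc κ]
    exact hnorm S k _ (by positivity) (fun n hn => hratio _ _ _ (hS n hn k)) v
  · rw [mul_assoc κ]
    exact hnorm Sᶜ (-k) _ (by positivity) (fun n hn => hratio _ _ _ (hS' n hn k)) v
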